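/- Let A and B be finite nonempty sets, let c : A × B → ℝ, let φ ∈ ℝ, let k be an integer with 1 ≤ k ≤ |B|, and let β ∈ ℝ satisfy β < c(i, j) for all i ∈ A and j ∈ B. Let s be an element not in B, and extend c to c' on A × (B ∪ {s}) by c'(i, j) = c(i, j) for j ∈ B and c'(i, s) = β. Then there exists M ⊆ B with |M| = k and single-coverage cost ∑_{i ∈ A} min_{j ∈ M} c(i, j) ≤ φ if and only if there exists M' ⊆ B ∪ {s} with |M'| = k + 1 and double-coverage cost ∑_{i ∈ A} min_{{j₁, j₂} ⊆ M', j₁ ≠ j₂} (c'(i, j₁) + c'(i, j₂)) ≤ φ + |A|·β. -/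

import Mathlib

/-- If `b` bounds `g` from below on `M`, then the sum of any two values of `g` on `M` is at least
`b` plus the minimum of `g` on `M` with one point removed. -/
theorem Finset.inf'_erase_add_le_inf'_powersetCard_two {J : Type*} [DecidableEq J]
    {M : Finset J} {e : J} {g : J → ℝ} {b : ℝ} (hb : ∀ j ∈ M, b ≤ g j)
    (hM : (M.erase e).Nonempty) (hP : (M.powersetCard 2).Nonempty) :
    (M.erase e).inf' hM g + b ≤ (M.powersetCard 2).inf' hP (fun P => ∑ j ∈ P, g j) := by
  refine Finset.le_inf' hP _ fun P hPM => ?_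
  obtain ⟨hsub, hcard⟩ := Finset.mem_powersetCard.mp hPM
  obtain ⟨x, y, hxy, rfl⟩ := Finset.card_eq_two.mp hcard
  have hx : x ∈ M := hsub (by simp)
  have hy : y ∈ M := hsub (by simp)
  rw [Finset.sum_pair hxy]
  by_cases hxe : x = e
  · have hmin := Finset.inf'_le g (Finset.mem_erase.mpr ⟨fun h => hxy (hxe.trans h.symm), hy⟩)
    linarith [hb x hx]
  · have hmin := Finset.inf'_le g (Finset.mem_erase.mpr ⟨hxe, hx⟩)
    linarith [hb y hy]

/-- The minimum of the pair sums of `g` over `insert s M` is at most `g s` plus the minimum of `g`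
over `M`. -/
theorem Finset.inf'_powersetCard_two_insert_le {J : Type*} [DecidableEq J]
    {M : Finset J} {s : J} (g : J → ℝ) (hs : s ∉ M) (hM : M.Nonempty)
    (hP : ((insert s M).powersetCard 2).Nonempty) :
    ((insert s M).powersetCard 2).inf' hP (fun P => ∑ j ∈ P, g j) ≤ M.inf' hM g + g s := by
  obtain ⟨j, hj, hmin⟩ := Finset.exists_mem_eq_inf' hM g
  have hsj : s ≠ j := fun h => hs (h ▸ hj)
  have hmem : {s, j} ∈ (insert s M).powersetCard 2 := by
    rw [Finset.mem_powersetCard]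
    exact ⟨Finset.insert_subset_insert s (Finset.singleton_subset_iff.mpr hj),
      Finset.card_pair hsj⟩
  have hle := Finset.inf'_le (fun P => ∑ j ∈ P, g j) hmem
  rw [Finset.sum_pair hsj] at hle
  linarith

/-- With `1 ≤ k ≤ |B|`, `b < c(i, j)` for all `i ∈ A`,
`j ∈ B`, and `c'` extending `c` to the fresh node `s` by `c'(i, s) = b`:
the SCP instance `⟨A, B, c, k, φ⟩` has a solution (some `M ⊆ B` with
`|M| = k` and single-coverage cost at most `φ`) if and only if the DCP
instance `⟨A, B ∪ {s}, c', k + 1, φ + |A|·b⟩` has a solution (some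
`M' ⊆ B ∪ {s}` with `|M'| = k + 1` and double-coverage cost at most
`φ + |A|·b`). -/
theorem scp_iff_dcp {I J : Type*} [DecidableEq J]
    (A : Finset I) (B : Finset J) (hA : A.Nonempty) (hB : B.Nonempty)
    (c : I → J → ℝ) (φ : ℝ) (k : ℕ) (hk1 : 1 ≤ k) (hk2 : k ≤ B.card)
    (b : ℝ) (hb : ∀ i ∈ A, ∀ j ∈ B, b < c i j)
    (s : J) (hs : s ∉ B)
    (c' : I → J → ℝ) (hc'B : ∀ i ∈ A, ∀ j ∈ B, c' i j = c i j)
    (hc's : ∀ i ∈ A, c' i s = b) :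
    (∃ M, M ⊆ B ∧ ∃ hM : M.Nonempty, M.card = k ∧
        ∑ i ∈ A, M.inf' hM (c i) ≤ φ) ↔
      (∃ M', M' ⊆ insert s B ∧ ∃ hM' : (M'.powersetCard 2).Nonempty,
        M'.card = k + 1 ∧
        ∑ i ∈ A, (M'.powersetCard 2).inf' hM' (fun P => ∑ j ∈ P, c' i j)
          ≤ φ + A.card * b) := by
  constructor
  · rintro ⟨M, hMB, hM, hcard, hcost⟩
    have hsM : s ∉ M := fun h => hs (hMB h)
    have hcard' : (insert s M).card = k + 1 := by rw [Finset.card_insert_of_notMem hsM, hcard]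
    have hP : ((insert s M).powersetCard 2).Nonempty :=
      Finset.powersetCard_nonempty.mpr (by omega)
    refine ⟨insert s M, Finset.insert_subset_insert s hMB, hP, hcard', ?_⟩
    calc
      _ ≤ ∑ i ∈ A, (M.inf' hM (c i) + b) := by
        refine Finset.sum_le_sum fun i hi => ?_
        rw [← Finset.inf'_congr hM rfl fun j hj => hc'B i hi j (hMB hj), ← hc's i hi]
        exact Finset.inf'_powersetCard_two_insert_le (c' i) hsM hM hP
      _ = ∑ i ∈ A, M.inf' hM (c i) + A.card * b := by
        rw [Finset.sum_add_distrib, Finset.sum_const, nsmul_eq_mul]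
      _ ≤ φ + A.card * b := by gcongr
  · rintro ⟨M', hMB, hP, hcard, hcost⟩
    obtain ⟨e, he, hsub⟩ : ∃ e ∈ M', M'.erase e ⊆ B := by
      by_cases hsM : s ∈ M'
      · exact ⟨s, hsM, Finset.subset_insert_iff.mp hMB⟩
      · obtain ⟨e, he⟩ : M'.Nonempty := Finset.card_pos.mp (by omega)
        exact ⟨e, he, (Finset.erase_subset e M').trans
          ((Finset.subset_insert_iff_of_notMem hsM).mp hMB)⟩
    have hcard' : (M'.erase e).card = k := by rw [Finset.card_erase_of_mem he, hcard]; rfl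
    have hM : (M'.erase e).Nonempty := Finset.card_pos.mp (by omega)
    refine ⟨M'.erase e, hsub, hM, hcard', ?_⟩
    have hsum : ∑ i ∈ A, ((M'.erase e).inf' hM (c i) + b) ≤
        ∑ i ∈ A, (M'.powersetCard 2).inf' hP (fun P => ∑ j ∈ P, c' i j) := by
      refine Finset.sum_le_sum fun i hi => ?_
      rw [← Finset.inf'_congr hM rfl fun j hj => hc'B i hi j (hsub hj)]
      refine Finset.inf'_erase_add_le_inf'_powersetCard_two (fun j hj => ?_) hM hP
      rcases Finset.mem_insert.mp (hMB hj) with rfl | hjB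
      · exact (hc's i hi).ge
      · exact (hb i hi j hjB).le.trans_eq (hc'B i hi j hjB).symm
    rw [Finset.sum_add_distrib, Finset.sum_const, nsmul_eq_mul] at hsum
    linarith
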